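/- Initiality for an arbitrary algebraic signature with binding: an arity is a list of natural numbers a = (a₁, …, a_r); for a monad R on Type, let R^(n) denote the n-th derived module (R^(n) X := R (Option^n X), with action bind (comm_R^n f), where comm_R is iterated n times), and let T^a R X := R^(a₁) X × ⋯ × R^(a_r) X with the componentwise R-module structure. A signature is a family of arities Σ : I → List ℕ, and a representation of Σ in R is a family of R-linear morphisms r_i : ∀ X, T^(Σ i) R X → R X (i : I). A morphism of representations (R, r) → (P, p) is a morphism of monads φ : R → P such that φ ∘ r_i = p_i ∘ (the map induced by applying φ, suitably derived, in each component) for every i. Theorem: for every signature Σ there exists a representation (S, s) of Σ that is initial: for every representation (R, r) of Σ there is a unique morphism of representations (S, s) → (R, r). -/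

import Mathlib

universe u

structure MonadOn : Type (u + 1) where
  F : Type u → Type u
  unit : ∀ X : Type u, X → F X
  bind : ∀ X Y : Type u, (X → F Y) → F X → F Y
  bind_bind : ∀ (X Y Z : Type u) (f : X → F Y) (g : Y → F Z) (x : F X),
    bind Y Z g (bind X Y f x) = bind X Z (fun u => bind Y Z g (f u)) x
  bind_unit : ∀ (X Y : Type u) (f : X → F Y) (x : X), bind X Y f (unit X x) = f x
  unit_bind : ∀ (X : Type u) (x : F X), bind X X (unit X) x = x

/-- `comm_R f : Option X → R (Option Y)` for `f : X → R Y`. -/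
def MonadOn.comm (R : MonadOn.{u}) {X Y : Type u} (f : X → R.F Y) :
    Option X → R.F (Option Y)
  | some a => R.bind Y (Option Y) (fun y => R.unit (Option Y) (some y)) (f a)
  | none => R.unit (Option Y) none

/-- A morphism of monads. -/
structure MonadOnHom (A B : MonadOn.{u}) : Type (u + 1) where
  app : ∀ X : Type u, A.F X → B.F X
  app_unit : ∀ (X : Type u) (x : X), app X (A.unit X x) = B.unit X x
  app_bind : ∀ (X Y : Type u) (f : X → A.F Y) (x : A.F X),
    app Y (A.bind X Y f x) = B.bind X Y (fun u => app Y (f u)) (app X x)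

/-- `optn n X = Option^n X`. -/
def optn : ℕ → Type u → Type u
  | 0, X => X
  | n + 1, X => Option (optn n X)

/-- Iterated `comm`, giving the action of the `n`-th derived module. -/
def MonadOn.commn (R : MonadOn.{u}) :
    ∀ (n : ℕ) {X Y : Type u}, (X → R.F Y) → optn n X → R.F (optn n Y)
  | 0, _, _, f => f
  | n + 1, _, _, f => R.comm (R.commn n f)

/-- `T^a R X := R^(a₁) X × ⋯ × R^(a_r) X` for an arity `a = (a₁, …, a_r)`. -/
def TA (R : MonadOn.{u}) : List ℕ → Type u → Type u
  | [], _ => PUnit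
  | n :: a, X => R.F (optn n X) × TA R a X

/-- The componentwise left `R`-module structure on `T^a R`. -/
def TA.mbind (R : MonadOn.{u}) :
    ∀ (a : List ℕ) {X Y : Type u}, (X → R.F Y) → TA R a X → TA R a Y
  | [], _, _, _, _ => PUnit.unit
  | n :: a, X, Y, f, p =>
      (R.bind (optn n X) (optn n Y) (R.commn n f) p.1, TA.mbind R a f p.2)

/-- The map `T^a R X → T^a P X` induced componentwise by a family
`φ : ∀ X, R X → P X` (suitably derived in each component). -/
def TA.map {R P : MonadOn.{u}} (φ : ∀ X : Type u, R.F X → P.F X) :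
    ∀ (a : List ℕ) (X : Type u), TA R a X → TA P a X
  | [], _, _ => PUnit.unit
  | n :: a, X, p => (φ (optn n X) p.1, TA.map φ a X p.2)

/-- A representation of a signature `sig : I → List ℕ`: a monad `R` together
with an `R`-linear morphism `T^(sig i) R → R` for each `i`. -/
structure SigRepr {I : Type u} (sig : I → List ℕ) : Type (u + 1) where
  R : MonadOn.{u}
  act : ∀ (i : I) (X : Type u), TA R (sig i) X → R.F X
  act_linear : ∀ (i : I) (X Y : Type u) (f : X → R.F Y) (t : TA R (sig i) X),
    act i Y (TA.mbind R (sig i) f t) = R.bind X Y f (act i X t)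

/-- The context `X` extended by successive blocks of bound variables. -/
def ctx : List ℕ → Type u → Type u
  | [], X => X
  | k :: l, X => optn k (ctx l X)

/-- The action of the functor `optn k` on maps. -/
def optnMap {A B : Type u} (h : A → B) : ∀ k : ℕ, optn k A → optn k B
  | 0 => h
  | k + 1 => Option.map (optnMap h k)

theorem optnMap_id {A : Type u} (k : ℕ) (a : optn k A) : optnMap (fun x : A => x) k a = a := by
  induction k with
  | zero => rfl
  | succ k ih =>
    cases a with
    | none => rfl
    | some a => exact congrArg some (ih a)

theorem optnMap_comp {A B C : Type u} (h : A → B) (g : B → C) (k : ℕ) (a : optn k A) :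
    optnMap g k (optnMap h k a) = optnMap (fun x => g (h x)) k a := by
  induction k with
  | zero => rfl
  | succ k ih =>
    cases a with
    | none => rfl
    | some a => exact congrArg some (ih a)

theorem MonadOn.commn_unit (R : MonadOn.{u}) {A B : Type u} (h : A → B) (k : ℕ) (a : optn k A) :
    R.commn k (fun x => R.unit B (h x)) a = R.unit (optn k B) (optnMap h k a) := by
  induction k with
  | zero => rfl
  | succ k ih =>
    cases a with
    | none => rfl
    | some a => exact (congrArg _ (ih a)).trans (R.bind_unit _ _ _ _)

mutual
/-- Terms over a signature, in the context `ctx l X`. Keeping `X` as a parameter, with the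
bound variables recorded by the index `l`, keeps the family in `Type u`. -/
inductive SigTerm {I : Type u} (sig : I → List ℕ) (X : Type u) : List ℕ → Type u
  | var {l : List ℕ} (x : ctx l X) : SigTerm sig X l
  | op {l : List ℕ} (i : I) (ts : SigArgs sig X (sig i) l) : SigTerm sig X l
/-- Lists of arguments for an operation of arity `a`. -/
inductive SigArgs {I : Type u} (sig : I → List ℕ) (X : Type u) : List ℕ → List ℕ → Type u
  | nil {l : List ℕ} : SigArgs sig X [] l
  | cons {k : ℕ} {a l : List ℕ} (t : SigTerm sig X (k :: l)) (ts : SigArgs sig X a l) :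
      SigArgs sig X (k :: a) l
end

namespace SigTerm

variable {I : Type u} {sig : I → List ℕ} {X Y Z : Type u} {l m n : List ℕ}

mutual
/-- Renaming of variables. -/
def ren {X Y : Type u} : ∀ {l m : List ℕ}, (ctx l X → ctx m Y) → SigTerm sig X l → SigTerm sig Y m
  | _, _, h, .var x => .var (h x)
  | _, _, h, .op i ts => .op i (renArgs h ts)
/-- Renaming of variables in a list of arguments. -/
def renArgs {X Y : Type u} : ∀ {a l m : List ℕ}, (ctx l X → ctx m Y) →
    SigArgs sig X a l → SigArgs sig Y a m
  | _, _, _, _, .nil => .nil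
  | _, _, _, h, .cons (k := k) t ts => .cons (ren (optnMap h k) t) (renArgs h ts)
end

theorem ren_apply_var (h : ctx l X → ctx m Y) (x : ctx l X) :
    ren h (.var x : SigTerm sig X l) = .var (h x) := by rw [ren]

mutual
theorem ren_id : ∀ {l : List ℕ} (t : SigTerm sig X l), ren (fun x => x) t = t
  | _, .var x => by rw [ren]
  | _, .op i ts => by rw [ren, renArgs_id ts]
theorem renArgs_id : ∀ {a l : List ℕ} (ts : SigArgs sig X a l), renArgs (fun x => x) ts = ts
  | _, _, .nil => by rw [renArgs]
  | _, _, .cons (k := k) t ts => by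
    rw [renArgs, renArgs_id ts, funext (optnMap_id k)]
    exact congrArg (SigArgs.cons · ts) (ren_id t)
end

mutual
theorem ren_ren : ∀ {l m n : List ℕ} (h : ctx l X → ctx m Y) (g : ctx m Y → ctx n Z)
    (t : SigTerm sig X l), ren g (ren h t) = ren (fun x => g (h x)) t
  | _, _, _, h, g, .var x => by simp only [ren]
  | _, _, _, h, g, .op i ts => by simp only [ren, renArgs_renArgs h g ts]
theorem renArgs_renArgs : ∀ {a l m n : List ℕ} (h : ctx l X → ctx m Y) (g : ctx m Y → ctx n Z)
    (ts : SigArgs sig X a l), renArgs g (renArgs h ts) = renArgs (fun x => g (h x)) ts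
  | _, _, _, _, h, g, .nil => by simp only [renArgs]
  | _, l, m, n, h, g, .cons (k := k) t ts => by
    simp only [renArgs, renArgs_renArgs h g ts]
    rw [← funext (optnMap_comp h g k)]
    exact congrArg (SigArgs.cons · _)
      (ren_ren (l := k :: l) (m := k :: m) (n := k :: n) (optnMap h k) (optnMap g k) t)
end

/-- Extension of a substitution under `k` binders. -/
def lift (f : ctx l X → SigTerm sig Y m) : ∀ k : ℕ, ctx (k :: l) X → SigTerm sig Y (k :: m)
  | 0, x => ren (l := m) (m := 0 :: m) (fun y => y) (f x)
  | k + 1, some x => ren (l := k :: m) (m := (k + 1) :: m) some (lift f k x)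
  | _ + 1, none => .var none

mutual
/-- Simultaneous capture-avoiding substitution. -/
def subst {X Y : Type u} : ∀ {l m : List ℕ}, (ctx l X → SigTerm sig Y m) →
    SigTerm sig X l → SigTerm sig Y m
  | _, _, f, .var x => f x
  | _, _, f, .op i ts => .op i (substArgs f ts)
/-- Simultaneous capture-avoiding substitution in a list of arguments. -/
def substArgs {X Y : Type u} : ∀ {a l m : List ℕ}, (ctx l X → SigTerm sig Y m) →
    SigArgs sig X a l → SigArgs sig Y a m
  | _, _, _, _, .nil => .nil
  | _, _, _, f, .cons (k := k) t ts => .cons (subst (lift f k) t) (substArgs f ts)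
end

theorem subst_apply_var (f : ctx l X → SigTerm sig Y m) (x : ctx l X) :
    subst f (.var x) = f x := by rw [subst]

theorem subst_apply_op (f : ctx l X → SigTerm sig Y m) (i : I) (ts : SigArgs sig X (sig i) l) :
    subst f (.op i ts) = .op i (substArgs f ts) := by rw [subst]

theorem lift_optnMap (h : ctx l X → ctx m Y) (f : ctx m Y → SigTerm sig Z n) (k : ℕ)
    (x : ctx (k :: l) X) : lift f k (optnMap h k x) = lift (fun x => f (h x)) k x := by
  induction k with
  | zero => rfl
  | succ k ih =>
    cases x with
    | none => rfl
    | some x => exact congrArg (ren (l := k :: n) (m := (k + 1) :: n) some) (ih x)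

mutual
theorem subst_ren : ∀ {l m n : List ℕ} (h : ctx l X → ctx m Y) (f : ctx m Y → SigTerm sig Z n)
    (t : SigTerm sig X l), subst f (ren h t) = subst (fun x => f (h x)) t
  | _, _, _, h, f, .var x => by simp only [ren, subst]
  | _, _, _, h, f, .op i ts => by simp only [ren, subst, substArgs_renArgs h f ts]
theorem substArgs_renArgs : ∀ {a l m n : List ℕ} (h : ctx l X → ctx m Y)
    (f : ctx m Y → SigTerm sig Z n) (ts : SigArgs sig X a l),
    substArgs f (renArgs h ts) = substArgs (fun x => f (h x)) ts
  | _, _, _, _, h, f, .nil => by simp only [renArgs, substArgs]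
  | _, l, m, _, h, f, .cons (k := k) t ts => by
    simp only [renArgs, substArgs, substArgs_renArgs h f ts]
    rw [← funext (lift_optnMap h f k)]
    exact congrArg (SigArgs.cons · _)
      (subst_ren (l := k :: l) (m := k :: m) (optnMap h k) (lift f k) t)
end

theorem ren_lift (f : ctx l X → SigTerm sig Y m) (h : ctx m Y → ctx n Z) (k : ℕ)
    (x : ctx (k :: l) X) :
    ren (m := k :: n) (optnMap h k) (lift f k x) = lift (fun x => ren h (f x)) k x := by
  induction k with
  | zero => exact (ren_ren _ _ _).trans (ren_ren (n := 0 :: n) h (fun z => z) (f x)).symm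
  | succ k ih =>
    cases x with
    | none => simp only [lift, ren]; rfl
    | some x =>
      refine (ren_ren _ _ _).trans (Eq.trans ?_
        (congrArg (ren (l := k :: n) (m := (k + 1) :: n) some) (ih x)))
      exact (ren_ren (m := k :: n) _ _ _).symm

mutual
theorem ren_subst : ∀ {l m n : List ℕ} (f : ctx l X → SigTerm sig Y m) (h : ctx m Y → ctx n Z)
    (t : SigTerm sig X l), ren h (subst f t) = subst (fun x => ren h (f x)) t
  | _, _, _, f, h, .var x => by simp only [subst]
  | _, _, _, f, h, .op i ts => by simp only [ren, subst, renArgs_substArgs f h ts]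
theorem renArgs_substArgs : ∀ {a l m n : List ℕ} (f : ctx l X → SigTerm sig Y m)
    (h : ctx m Y → ctx n Z) (ts : SigArgs sig X a l),
    renArgs h (substArgs f ts) = substArgs (fun x => ren h (f x)) ts
  | _, _, _, _, f, h, .nil => by simp only [renArgs, substArgs]
  | _, _, m, n, f, h, .cons (k := k) t ts => by
    simp only [renArgs, substArgs, renArgs_substArgs f h ts]
    rw [← funext (ren_lift f h k)]
    exact congrArg (SigArgs.cons · _)
      (ren_subst (m := k :: m) (n := k :: n) (lift f k) (optnMap h k) t)
end

theorem subst_lift (f : ctx l X → SigTerm sig Y m) (g : ctx m Y → SigTerm sig Z n) (k : ℕ)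
    (x : ctx (k :: l) X) : subst (lift g k) (lift f k x) = lift (fun x => subst g (f x)) k x := by
  induction k with
  | zero => exact (subst_ren _ _ _).trans (ren_subst _ _ _).symm
  | succ k ih =>
    cases x with
    | none => simp only [lift, subst]
    | some x =>
      refine (subst_ren _ _ _).trans (Eq.trans ?_
        (congrArg (ren (l := k :: n) (m := (k + 1) :: n) some) (ih x)))
      exact (ren_subst _ _ _).symm

mutual
theorem subst_subst : ∀ {l m n : List ℕ} (f : ctx l X → SigTerm sig Y m)
    (g : ctx m Y → SigTerm sig Z n) (t : SigTerm sig X l),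
    subst g (subst f t) = subst (fun x => subst g (f x)) t
  | _, _, _, f, g, .var x => by simp only [subst]
  | _, _, _, f, g, .op i ts => by simp only [subst, substArgs_substArgs f g ts]
theorem substArgs_substArgs : ∀ {a l m n : List ℕ} (f : ctx l X → SigTerm sig Y m)
    (g : ctx m Y → SigTerm sig Z n) (ts : SigArgs sig X a l),
    substArgs g (substArgs f ts) = substArgs (fun x => subst g (f x)) ts
  | _, _, _, _, f, g, .nil => by simp only [substArgs]
  | _, _, _, _, f, g, .cons (k := k) t ts => by
    simp only [substArgs, substArgs_substArgs f g ts, subst_subst (lift f k) (lift g k) t,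
      subst_lift]
end

theorem lift_var (h : ctx l X → ctx m Y) (k : ℕ) (x : ctx (k :: l) X) :
    lift (sig := sig) (fun x => .var (h x)) k x = .var (optnMap h k x) := by
  induction k with
  | zero => exact ren_apply_var (l := m) (m := 0 :: m) _ _
  | succ k ih =>
    cases x with
    | none => rfl
    | some x =>
      refine (congrArg (ren (l := k :: m) (m := (k + 1) :: m) some) (ih x)).trans ?_
      exact ren_apply_var (l := k :: m) (m := (k + 1) :: m) _ _

mutual
theorem subst_var : ∀ {l m : List ℕ} (h : ctx l X → ctx m Y) (t : SigTerm sig X l),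
    subst (fun x => .var (h x)) t = ren h t
  | _, _, h, .var x => by simp only [subst, ren]
  | _, _, h, .op i ts => by simp only [subst, ren, substArgs_var h ts]
theorem substArgs_var : ∀ {a l m : List ℕ} (h : ctx l X → ctx m Y) (ts : SigArgs sig X a l),
    substArgs (fun x => .var (h x)) ts = renArgs h ts
  | _, _, _, h, .nil => by simp only [substArgs, renArgs]
  | _, l, m, h, .cons (k := k) t ts => by
    simp only [substArgs, renArgs, substArgs_var h ts]
    rw [funext (lift_var h k)]
    exact congrArg (SigArgs.cons · _)
      (subst_var (l := k :: l) (m := k :: m) (optnMap h k) t)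
end

/-- The term monad of a signature. -/
def monad (sig : I → List ℕ) : MonadOn.{u} where
  F X := SigTerm sig X []
  unit _ x := .var x
  bind _ _ f t := subst f t
  bind_bind _ _ _ f g t := subst_subst f g t
  bind_unit _ _ f x := subst_apply_var (l := []) (m := []) f x
  unit_bind _ t := (subst_var (fun x => x) t).trans (ren_id t)

/-- Regards a term in the context `ctx l X` as a term in that context without bound variables. -/
def flatten (t : SigTerm sig X l) : SigTerm sig (ctx l X) [] :=
  ren (l := l) (m := []) (X := X) (Y := ctx l X) (fun x => x) t

/-- Regards `k` of the free variables of a term as bound variables. -/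
def bindVars {k : ℕ} (t : SigTerm sig (optn k X) []) : SigTerm sig X [k] :=
  ren (l := []) (m := [k]) (fun x => x) t

theorem lift_eq_bindVars_commn (f : X → SigTerm sig Y []) (k : ℕ) (x : optn k X) :
    lift (l := []) f k x = bindVars ((monad sig).commn k f x) := by
  induction k with
  | zero => rfl
  | succ k ih =>
    cases x with
    | none =>
      exact (ren_apply_var (X := optn (k + 1) Y) (Y := Y) (l := []) (m := [k + 1])
        (fun y => y) none).symm
    | some x =>
      refine (congrArg (ren (l := [k]) (m := [k + 1]) some) (ih x)).trans ?_
      refine (ren_ren _ _ _).trans ?_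
      refine Eq.trans ?_ (congrArg bindVars (subst_var (l := []) (m := []) some _).symm)
      exact (ren_ren (X := optn k Y) (Y := optn (k + 1) Y) (Z := Y) (l := []) (m := [])
        (n := [k + 1]) some (fun y => y) _).symm

/-- The arguments given by an element of the module `T^a` of the term monad. -/
def ofTA : ∀ {a : List ℕ}, TA (monad sig) a X → SigArgs sig X a []
  | [], _ => .nil
  | _ :: _, p => .cons (bindVars p.1) (ofTA p.2)

/-- The element of the module `T^a` of the term monad given by a list of arguments. -/
def toTA : ∀ {a l : List ℕ}, SigArgs sig X a l → TA (monad sig) a (ctx l X)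
  | _, _, .nil => PUnit.unit
  | _, _, .cons t ts => (flatten t, toTA ts)

theorem ofTA_toTA : ∀ {a l : List ℕ} (ts : SigArgs sig X a l),
    ofTA (toTA ts) = renArgs (l := l) (m := []) (X := X) (Y := ctx l X) (fun x => x) ts
  | _, _, .nil => rfl
  | _, l, .cons (k := k) (a := a) t ts => by
    refine congrArg₂ SigArgs.cons ?_ (ofTA_toTA ts)
    refine (ren_ren _ _ _).trans ?_
    exact congrArg (ren (l := k :: l) (m := [k]) (X := X) (Y := ctx l X) · t)
      (funext (optnMap_id k)).symm

theorem ofTA_mbind (f : X → SigTerm sig Y []) : ∀ {a : List ℕ} (p : TA (monad sig) a X),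
    ofTA (TA.mbind (monad sig) a f p) = substArgs (l := []) f (ofTA p)
  | [], _ => by simp only [ofTA, substArgs]
  | k :: a, p => by
    simp only [ofTA, substArgs, TA.mbind, ofTA_mbind f p.2]
    refine congrArg (SigArgs.cons · _) ?_
    refine (ren_subst _ _ _).trans ((congrArg (subst · p.1) ?_).trans (subst_ren _ _ _).symm)
    exact funext fun x => (lift_eq_bindVars_commn f k x).symm

/-- The representation of a signature in its term monad. -/
def repr (sig : I → List ℕ) : SigRepr sig where
  R := monad sig
  act i _ p := .op i (ofTA p)
  act_linear i _ _ f p := by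
    rw [ofTA_mbind f p]
    exact (subst_apply_op (l := []) (m := []) f i (ofTA p)).symm

section Fold

variable (T : SigRepr sig)

mutual
/-- Interpretation of terms in a representation. -/
def fold {X : Type u} : ∀ {l : List ℕ}, SigTerm sig X l → T.R.F (ctx l X)
  | _, .var x => T.R.unit _ x
  | _, .op i ts => T.act i _ (foldArgs ts)
/-- Interpretation of lists of arguments in a representation. -/
def foldArgs {X : Type u} : ∀ {a l : List ℕ}, SigArgs sig X a l → TA T.R a (ctx l X)
  | _, _, .nil => PUnit.unit
  | _, _, .cons t ts => (fold t, foldArgs ts)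
end

mutual
theorem fold_ren : ∀ {l m : List ℕ} (h : ctx l X → ctx m Y) (t : SigTerm sig X l),
    fold T (ren h t) = T.R.bind _ _ (fun x => T.R.unit _ (h x)) (fold T t)
  | _, _, h, .var x => by simp only [ren, fold, T.R.bind_unit]
  | _, _, h, .op i ts => by simp only [ren, fold, foldArgs_renArgs h ts, T.act_linear]
theorem foldArgs_renArgs : ∀ {a l m : List ℕ} (h : ctx l X → ctx m Y) (ts : SigArgs sig X a l),
    foldArgs T (renArgs h ts) = TA.mbind T.R a (fun x => T.R.unit _ (h x)) (foldArgs T ts)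
  | _, _, _, h, .nil => rfl
  | _, l, m, h, .cons (k := k) t ts => by
    simp only [renArgs, foldArgs, TA.mbind, foldArgs_renArgs h ts]
    rw [funext (T.R.commn_unit h k)]
    exact congrArg (Prod.mk · _) (fold_ren (l := k :: l) (m := k :: m) (optnMap h k) t)
end

theorem commn_fold (f : ctx l X → SigTerm sig Y m) (k : ℕ) (x : ctx (k :: l) X) :
    T.R.commn k (fun x => fold T (f x)) x = fold T (lift f k x) := by
  induction k with
  | zero => exact ((fold_ren T (l := m) (m := 0 :: m) _ _).trans (T.R.unit_bind _ _)).symm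
  | succ k ih =>
    cases x with
    | none => simp only [lift, fold]; rfl
    | some x =>
      exact (congrArg (T.R.bind _ _ _) (ih x)).trans
        (fold_ren T (l := k :: m) (m := (k + 1) :: m) some _).symm

mutual
theorem fold_subst : ∀ {l m : List ℕ} (f : ctx l X → SigTerm sig Y m) (t : SigTerm sig X l),
    fold T (subst f t) = T.R.bind _ _ (fun x => fold T (f x)) (fold T t)
  | _, _, f, .var x => by simp only [subst, fold, T.R.bind_unit]
  | _, _, f, .op i ts => by simp only [subst, fold, foldArgs_substArgs f ts, T.act_linear]
theorem foldArgs_substArgs : ∀ {a l m : List ℕ} (f : ctx l X → SigTerm sig Y m)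
    (ts : SigArgs sig X a l),
    foldArgs T (substArgs f ts) = TA.mbind T.R a (fun x => fold T (f x)) (foldArgs T ts)
  | _, _, _, f, .nil => rfl
  | _, _, _, f, .cons (k := k) t ts => by
    simp only [substArgs, foldArgs, TA.mbind, foldArgs_substArgs f ts]
    rw [funext (commn_fold T f k)]
    exact congrArg (Prod.mk · _) (fold_subst (lift f k) t)
end

/-- Interpretation of terms as a morphism of monads. -/
def foldHom : MonadOnHom (monad sig) T.R where
  app _ t := fold T t
  app_unit _ x := by simp only [monad, fold]; rfl
  app_bind _ _ f t := fold_subst T (l := []) (m := []) f t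

theorem foldArgs_ofTA : ∀ {a : List ℕ} (p : TA (monad sig) a X),
    foldArgs T (ofTA p) = TA.map (foldHom T).app a X p
  | [], _ => rfl
  | _ :: _, p => by
    simp only [ofTA, foldArgs, TA.map, foldArgs_ofTA p.2]
    exact congrArg (Prod.mk · _) ((fold_ren T _ _).trans (T.R.unit_bind _ _))

variable {T}

mutual
theorem app_flatten (φ : MonadOnHom (monad sig) T.R)
    (hφ : ∀ (i : I) (X : Type u) (p : TA (monad sig) (sig i) X),
      φ.app X ((repr sig).act i X p) = T.act i X (TA.map φ.app (sig i) X p)) :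
    ∀ {l : List ℕ} (t : SigTerm sig X l), φ.app (ctx l X) (flatten t) = fold T t
  | _, .var x => by
    simp only [flatten, ren, fold]
    exact φ.app_unit _ x
  | l, .op i ts => by
    simp only [flatten, ren, fold, ← map_toTA φ hφ ts, ← ofTA_toTA]
    exact hφ i _ (toTA ts)
theorem map_toTA (φ : MonadOnHom (monad sig) T.R)
    (hφ : ∀ (i : I) (X : Type u) (p : TA (monad sig) (sig i) X),
      φ.app X ((repr sig).act i X p) = T.act i X (TA.map φ.app (sig i) X p)) :
    ∀ {a l : List ℕ} (ts : SigArgs sig X a l),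
      TA.map φ.app a (ctx l X) (toTA ts) = foldArgs T ts
  | _, _, .nil => rfl
  | _, _, .cons t ts => by
    simp only [toTA, TA.map, foldArgs, map_toTA φ hφ ts]
    exact congrArg (Prod.mk · _) (app_flatten φ hφ t)
end

theorem eq_foldHom (φ : MonadOnHom (monad sig) T.R)
    (hφ : ∀ (i : I) (X : Type u) (p : TA (monad sig) (sig i) X),
      φ.app X ((repr sig).act i X p) = T.act i X (TA.map φ.app (sig i) X p)) :
    φ = foldHom T := by
  have h : φ.app = (foldHom T).app := by
    funext X t
    exact (congrArg (φ.app X) (ren_id t).symm).trans (app_flatten (l := []) φ hφ t)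
  obtain ⟨app, _, _⟩ := φ
  cases h
  rfl

end Fold

end SigTerm

/-- For every signature `Σ` there is an initial
representation of `Σ`: a representation `S` such that for every
representation `T` there is a unique morphism of monads `S.R → T.R`
commuting with the representation structure. -/
theorem signature_representation_initial
    {I : Type u} (sig : I → List ℕ) :
    ∃ S : SigRepr sig, ∀ T : SigRepr sig,
      ∃! φ : MonadOnHom S.R T.R,
        ∀ (i : I) (X : Type u) (t : TA S.R (sig i) X),
          φ.app X (S.act i X t) = T.act i X (TA.map φ.app (sig i) X t) := by
  refine ⟨SigTerm.repr sig, fun T => ⟨SigTerm.foldHom T, fun i X p => ?_,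
    fun φ hφ => SigTerm.eq_foldHom φ hφ⟩⟩
  exact congrArg (T.act i X) (SigTerm.foldArgs_ofTA T p)
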